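/- arXiv:2008.05127 — 3 statements merged into one kernel-verified Lean document; each statement's English description precedes it below -/
import Mathlib

section
/- Let N ≥ 3 and let k, l be integers with 0 ≤ l < k. The constant ((N−1)/2)^{2(k−l)} in the higher order radial Poincaré inequality is sharp: for every real Λ > ((N−1)/2)^{2(k−l)} there exists a nonzero u ∈ C_c^∞(ℍ^N) such that ∫_{ℍ^N} |∇_r^k u|² dv < Λ ∫_{ℍ^N} |∇_r^l u|² dv. -/
open MeasureTheory Real Set

noncomputable section

/-- The radial derivative `∇_r u = ∂u/∂r` of a function `u(r,σ)`. -/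
def radGrad (N : ℕ) (u : ℝ → EuclideanSpace ℝ (Fin N) → ℝ) :
    ℝ → EuclideanSpace ℝ (Fin N) → ℝ :=
  fun r σ => deriv (fun s => u s σ) r

/-- The radial Laplacian `Δ_r u = ∂²u/∂r² + (N-1) coth r · ∂u/∂r`. -/
def radLap (N : ℕ) (u : ℝ → EuclideanSpace ℝ (Fin N) → ℝ) :
    ℝ → EuclideanSpace ℝ (Fin N) → ℝ :=
  fun r σ => deriv (fun s => deriv (fun t => u t σ) s) r
    + ((N : ℝ) - 1) * (Real.cosh r / Real.sinh r) * deriv (fun s => u s σ) r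

/-- The higher order radial derivative `∇_r^k u`: `Δ_r^{k/2} u` for even `k`,
`∂_r (Δ_r^{(k-1)/2} u)` for odd `k`. -/
def radPow (N k : ℕ) (u : ℝ → EuclideanSpace ℝ (Fin N) → ℝ) :
    ℝ → EuclideanSpace ℝ (Fin N) → ℝ :=
  if Even k then (radLap N)^[k / 2] u else radGrad N ((radLap N)^[k / 2] u)

/-- The integral over the hyperbolic space `ℍ^N` in polar coordinates:
`∫_{S^{N-1}} ∫_0^∞ F(r,σ) (sinh r)^{N-1} dr dσ`, where `dσ` is the standard
surface measure (the `(N-1)`-dimensional Hausdorff measure) on the unit sphere. -/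
def hypInt (N : ℕ) (F : ℝ → EuclideanSpace ℝ (Fin N) → ℝ) : ℝ :=
  ∫ σ in Metric.sphere (0 : EuclideanSpace ℝ (Fin N)) 1,
    (∫ r in Ioi (0 : ℝ), F r σ * Real.sinh r ^ (N - 1)) ∂μH[(N : ℝ) - 1]

/-- `u ∈ C_c^∞(ℍ^N)`: `u(r,σ)` smooth (including at the pole `r = 0`) and
vanishing for all `r` larger than some `R`. -/
def IsCc (N : ℕ) (u : ℝ → EuclideanSpace ℝ (Fin N) → ℝ) : Prop :=
  ContDiff ℝ (⊤ : ℕ∞) (Function.uncurry u) ∧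
  ∃ R : ℝ, ∀ r : ℝ, R < r → ∀ σ ∈ Metric.sphere (0 : EuclideanSpace ℝ (Fin N)) 1, u r σ = 0

/-- `u ∈ C_c^∞(ℍ^N \ {o})`: `u(r,σ)` smooth with support contained in
`[a,b] × S^{N-1}` for some `0 < a ≤ b`. -/
def IsCcAway (N : ℕ) (u : ℝ → EuclideanSpace ℝ (Fin N) → ℝ) : Prop :=
  ContDiff ℝ (⊤ : ℕ∞) (Function.uncurry u) ∧
  ∃ a b : ℝ, 0 < a ∧ a ≤ b ∧
    ∀ r : ℝ, r ∉ Icc a b → ∀ σ ∈ Metric.sphere (0 : EuclideanSpace ℝ (Fin N)) 1, u r σ = 0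

section SphereMeasure

variable {E : Type*} [NormedAddCommGroup E] [InnerProductSpace ℝ E]

/-- A vector splits into its component orthogonal to a unit vector `v` and its component
along `v`. -/
lemma orthogonalProjectionOnto_add_inner_smul {v : E} (hv : ‖v‖ = 1) (x : E) :
    (((ℝ ∙ v)ᗮ.orthogonalProjectionOnto x : (ℝ ∙ v)ᗮ) : E) + inner ℝ v x • v = x := by
  have h := Submodule.starProjection_orthogonal_val (K := ℝ ∙ v) x
  rw [Submodule.starProjection_unit_singleton ℝ hv] at h
  rw [Submodule.starProjection_apply] at h
  rw [h]
  abel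

lemma norm_add_smul_sq_of_mem_orthogonal {v : E} (hv : ‖v‖ = 1) (w : (ℝ ∙ v)ᗮ) (t : ℝ) :
    ‖(w : E) + t • v‖ ^ 2 = ‖w‖ ^ 2 + t ^ 2 := by
  have h : inner ℝ (w : E) (t • v) = 0 := by
    rw [inner_smul_right, real_inner_comm,
      Submodule.mem_orthogonal_singleton_iff_inner_right.1 w.2, mul_zero]
  have := norm_add_sq_eq_norm_sq_add_norm_sq_of_inner_eq_zero (w : E) (t • v) h
  rw [norm_smul, hv] at this
  simp only [← sq, mul_one, Real.norm_eq_abs, sq_abs] at this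
  simpa using this

variable [FiniteDimensional ℝ E] [MeasurableSpace E] [BorelSpace E] {n : ℕ}

lemma hausdorffMeasure_sphere_lt_top (hn : Module.finrank ℝ E = n + 1) :
    μH[(n : ℝ)] (Metric.sphere (0 : E) 1) < ⊤ := by
  have : Fact (Module.finrank ℝ E = n + 1) := ⟨hn⟩
  refine (isCompact_sphere (0 : E) 1).measure_lt_top_of_nhdsWithin fun v hv => ?_
  replace hv : ‖v‖ = 1 := by simpa using hv
  have hv0 : v ≠ 0 := fun h => by simp [h] at hv
  have hfin : Module.finrank ℝ (ℝ ∙ v)ᗮ = n := Submodule.finrank_orthogonal_span_singleton hv0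
  have : (μH[(n : ℝ)] : Measure (ℝ ∙ v)ᗮ).IsAddHaarMeasure := by
    rw [← hfin]; exact isAddHaarMeasure_hausdorffMeasure
  set g : (ℝ ∙ v)ᗮ → E := fun w => (w : E) + √(1 - ‖w‖ ^ 2) • v with hg
  have hgd : ContDiffAt ℝ 1 g 0 := by
    refine ((ℝ ∙ v)ᗮ.subtypeL.contDiff.contDiffAt).add (ContDiffAt.smul ?_ contDiffAt_const)
    refine ContDiffAt.sqrt ?_ (by simp)
    exact contDiffAt_const.sub (contDiff_norm_sq ℝ).contDiffAt
  obtain ⟨K, t, ht, hK⟩ := hgd.exists_lipschitzOnWith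
  obtain ⟨δ, hδ, hδt⟩ := Metric.nhds_basis_closedBall.mem_iff.1 ht
  have himage : μH[(n : ℝ)] (g '' Metric.closedBall 0 δ) < ⊤ := by
    refine ((hK.mono hδt).hausdorffMeasure_image_le n.cast_nonneg).trans_lt ?_
    exact ENNReal.mul_lt_top (ENNReal.rpow_lt_top_of_nonneg n.cast_nonneg ENNReal.coe_ne_top)
      (isCompact_closedBall _ _).measure_lt_top
  refine ⟨g '' Metric.closedBall 0 δ, ?_, himage⟩
  have h1 : ∀ᶠ x in nhds v, (ℝ ∙ v)ᗮ.orthogonalProjectionOnto x ∈ Metric.closedBall 0 δ := by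
    refine ((ℝ ∙ v)ᗮ.orthogonalProjectionOnto.continuous.tendsto v).eventually ?_
    rw [Submodule.orthogonalProjectionOnto_eq_zero_iff.2 (by simp)]
    exact Metric.closedBall_mem_nhds _ hδ
  have h2 : ∀ᶠ x in nhds v, 0 < inner ℝ v x := by
    have hc : Continuous fun x : E => inner ℝ v x := by fun_prop
    refine (hc.tendsto v).eventually (lt_mem_nhds ?_)
    rw [real_inner_self_eq_norm_sq, hv]
    norm_num
  filter_upwards [nhdsWithin_le_nhds h1, nhdsWithin_le_nhds h2, self_mem_nhdsWithin]
    with x hx1 hx2 hx3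
  refine ⟨_, hx1, ?_⟩
  have hx := orthogonalProjectionOnto_add_inner_smul hv x
  have hnorm := norm_add_smul_sq_of_mem_orthogonal hv
    ((ℝ ∙ v)ᗮ.orthogonalProjectionOnto x) (inner ℝ v x)
  rw [hx, mem_sphere_zero_iff_norm.1 hx3] at hnorm
  have hs : 1 - ‖(ℝ ∙ v)ᗮ.orthogonalProjectionOnto x‖ ^ 2 = (inner ℝ v x) ^ 2 := by linarith
  simp only [hg]
  rw [hs, Real.sqrt_sq hx2.le, hx]

lemma hausdorffMeasure_sphere_pos (hn : Module.finrank ℝ E = n + 1) :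
    0 < μH[(n : ℝ)] (Metric.sphere (0 : E) 1) := by
  have : Fact (Module.finrank ℝ E = n + 1) := ⟨hn⟩
  have : Nontrivial E := Module.nontrivial_of_finrank_pos (R := ℝ) (by omega)
  obtain ⟨v, hv⟩ := exists_norm_eq E zero_le_one
  have hv0 : v ≠ 0 := fun h => by simp [h] at hv
  have hfin : Module.finrank ℝ (ℝ ∙ v)ᗮ = n := Submodule.finrank_orthogonal_span_singleton hv0
  have : (μH[(n : ℝ)] : Measure (ℝ ∙ v)ᗮ).IsAddHaarMeasure := by
    rw [← hfin]; exact isAddHaarMeasure_hausdorffMeasure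
  have hle := (Submodule.lipschitzWith_orthogonalProjectionOnto
    (ℝ ∙ v)ᗮ).hausdorffMeasure_image_le (d := n) n.cast_nonneg (Metric.sphere (0 : E) 1)
  simp only [ENNReal.coe_one, ENNReal.one_rpow, one_mul] at hle
  refine lt_of_lt_of_le ?_ hle
  refine (Metric.measure_ball_pos _ (0 : (ℝ ∙ v)ᗮ) one_pos).trans_le (measure_mono fun w hw => ?_)
  have hw1 : ‖w‖ < 1 := by simpa using hw
  refine ⟨(w : E) + √(1 - ‖w‖ ^ 2) • v, ?_, ?_⟩
  · rw [mem_sphere_zero_iff_norm, ← sq_eq_sq₀ (norm_nonneg _) zero_le_one,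
      norm_add_smul_sq_of_mem_orthogonal hv, Real.sq_sqrt]
    · ring
    · nlinarith [norm_nonneg w]
  · simp

end SphereMeasure

section Rescaling

/-- The function `e^{-2s/ε}` of `p = (ε, s)`, extended by zero to `ε ≤ 0`; it is jointly smooth
on `s > 0`. -/
def expDecay (p : ℝ × ℝ) : ℝ := expNegInvGlue (p.1 / (2 * p.2))

lemma expDecay_lt_one (p : ℝ × ℝ) : expDecay p < 1 := by
  unfold expDecay expNegInvGlue
  split_ifs with h
  · exact one_pos
  · rw [Real.exp_lt_one_iff, neg_lt_zero, inv_pos]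
    exact not_le.1 h

lemma expDecay_zero_left (s : ℝ) : expDecay (0, s) = 0 := by
  simp [expDecay]

lemma expDecay_mul {ε r : ℝ} (hε : 0 < ε) (hr : 0 < r) :
    expDecay (ε, ε * r) = Real.exp (-(2 * r)) := by
  have h : ε / (2 * (ε * r)) = (2 * r)⁻¹ := by field_simp
  have hpos : ¬ (2 * r)⁻¹ ≤ 0 := by push Not; positivity
  simp only [expDecay, h, expNegInvGlue, if_neg hpos, inv_inv]

lemma contDiffAt_expDecay {p : ℝ × ℝ} (hp : 0 < p.2) : ContDiffAt ℝ (⊤ : ℕ∞) expDecay p := by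
  refine (expNegInvGlue.contDiff (n := ⊤)).contDiffAt.comp p ?_
  exact contDiffAt_fst.div (contDiffAt_const.mul contDiffAt_snd) (by positivity)

/-- The function `coth (s / ε)` of `p = (ε, s)`, extended by one to `ε ≤ 0`. -/
def cothRatio (p : ℝ × ℝ) : ℝ := (1 + expDecay p) / (1 - expDecay p)

lemma cothRatio_zero_left (s : ℝ) : cothRatio (0, s) = 1 := by
  simp [cothRatio, expDecay_zero_left]

lemma cothRatio_mul {ε r : ℝ} (hε : 0 < ε) (hr : 0 < r) :
    cothRatio (ε, ε * r) = Real.cosh r / Real.sinh r := by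
  have h1 : Real.exp (-(2 * r)) = Real.exp (-r) * Real.exp (-r) := by
    rw [← Real.exp_add]; ring_nf
  have h2 : Real.exp r * Real.exp (-r) = 1 := by rw [← Real.exp_add]; simp
  have h3 : 1 - Real.exp (-(2 * r)) ≠ 0 := by
    have := expDecay_lt_one (ε, ε * r)
    rw [expDecay_mul hε hr] at this
    linarith
  have h4 : Real.sinh r ≠ 0 := (Real.sinh_pos_iff.2 hr).ne'
  rw [cothRatio, expDecay_mul hε hr, div_eq_div_iff h3 h4, Real.cosh_eq, Real.sinh_eq, h1]
  linear_combination Real.exp (-r) * h2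

lemma contDiffAt_cothRatio {p : ℝ × ℝ} (hp : 0 < p.2) : ContDiffAt ℝ (⊤ : ℕ∞) cothRatio p :=
  (contDiffAt_const.add (contDiffAt_expDecay hp)).div
    (contDiffAt_const.sub (contDiffAt_expDecay hp)) (sub_ne_zero.2 (expDecay_lt_one p).ne')

/-- Smooth functions on `ℝ × ℝ` supported in the slab `ℝ × [1, 2]`. -/
structure SlabSmooth (G : ℝ × ℝ → ℝ) : Prop where
  contDiff : ContDiff ℝ (⊤ : ℕ∞) G
  eq_zero : ∀ p : ℝ × ℝ, p.2 ∉ Icc (1 : ℝ) 2 → G p = 0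

variable {G : ℝ × ℝ → ℝ} {A : ℝ × ℝ → ℝ}

lemma SlabSmooth.eventually_eq_zero (hG : SlabSmooth G) {p : ℝ × ℝ} (hp : p.2 ∉ Icc (1 : ℝ) 2) :
    G =ᶠ[nhds p] fun _ => 0 := by
  have h : ∀ᶠ q : ℝ × ℝ in nhds p, q.2 ∈ (Icc (1 : ℝ) 2)ᶜ :=
    continuous_snd.continuousAt.eventually (isClosed_Icc.isOpen_compl.mem_nhds hp)
  filter_upwards [h] with q hq using hG.eq_zero q hq

lemma SlabSmooth.mul_left (hG : SlabSmooth G)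
    (hA : ∀ p : ℝ × ℝ, 0 < p.2 → ContDiffAt ℝ (⊤ : ℕ∞) A p) :
    SlabSmooth fun p => A p * G p := by
  refine ⟨contDiff_iff_contDiffAt.2 fun p => ?_, fun p hp => by simp [hG.eq_zero p hp]⟩
  by_cases hp : 0 < p.2
  · exact (hA p hp).mul hG.contDiff.contDiffAt
  · have hp' : p.2 ∉ Icc (1 : ℝ) 2 := fun h => hp (one_pos.trans_le h.1)
    refine (contDiffAt_const (c := (0 : ℝ))).congr_of_eventuallyEq ?_
    filter_upwards [hG.eventually_eq_zero hp'] with q hq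
    simp [hq]

lemma SlabSmooth.add {H : ℝ × ℝ → ℝ} (hG : SlabSmooth G) (hH : SlabSmooth H) :
    SlabSmooth fun p => G p + H p :=
  ⟨hG.contDiff.add hH.contDiff, fun p hp => by simp [hG.eq_zero p hp, hH.eq_zero p hp]⟩

lemma SlabSmooth.hasDerivAt_snd (hG : SlabSmooth G) (p : ℝ × ℝ) :
    HasDerivAt (fun s => G (p.1, s)) (fderiv ℝ G p (0, 1)) p.2 := by
  have h1 : HasFDerivAt G (fderiv ℝ G p) (p.1, p.2) :=
    (hG.contDiff.differentiable (by simp) p).hasFDerivAt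
  exact h1.comp_hasDerivAt p.2 ((hasDerivAt_const p.2 p.1).prodMk (hasDerivAt_id p.2))

lemma SlabSmooth.deriv_snd (hG : SlabSmooth G) :
    SlabSmooth fun p => deriv (fun s => G (p.1, s)) p.2 := by
  have heq : (fun p : ℝ × ℝ => deriv (fun s => G (p.1, s)) p.2) = fun p => fderiv ℝ G p (0, 1) :=
    funext fun p => (hG.hasDerivAt_snd p).deriv
  rw [heq]
  refine ⟨(hG.contDiff.fderiv_right (m := ((⊤ : ℕ∞) : WithTop ℕ∞)) (by simp)).clm_apply
    contDiff_const, fun p hp => ?_⟩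
  rw [(hG.eventually_eq_zero hp).fderiv_eq]
  simp

/-- The conjugate of `∂_r` under `G ↦ e^{-cr} G (ε, εr)`. -/
def twistGrad (c : ℝ) (G : ℝ × ℝ → ℝ) (p : ℝ × ℝ) : ℝ :=
  -c * G p + p.1 * deriv (fun s => G (p.1, s)) p.2

/-- The conjugate of the radial Laplacian under `G ↦ e^{-cr} G (ε, εr)`, where
`2c = N - 1`. -/
def twistLap (c : ℝ) (G : ℝ × ℝ → ℝ) (p : ℝ × ℝ) : ℝ :=
  twistGrad c (twistGrad c G) p + 2 * c * cothRatio p * twistGrad c G p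

/-- The conjugate of `∇_r^k` under `G ↦ e^{-cr} G (ε, εr)`. -/
def twistPow (c : ℝ) (k : ℕ) (G : ℝ × ℝ → ℝ) : ℝ × ℝ → ℝ :=
  if Even k then (twistLap c)^[k / 2] G else twistGrad c ((twistLap c)^[k / 2] G)

lemma SlabSmooth.twistGrad (hG : SlabSmooth G) (c : ℝ) : SlabSmooth (twistGrad c G) :=
  (hG.mul_left fun _ _ => contDiffAt_const).add (hG.deriv_snd.mul_left fun _ _ => contDiffAt_fst)

lemma SlabSmooth.twistLap (hG : SlabSmooth G) (c : ℝ) : SlabSmooth (twistLap c G) :=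
  ((hG.twistGrad c).twistGrad c).add
    ((hG.twistGrad c).mul_left fun _ hp => contDiffAt_const.mul (contDiffAt_cothRatio hp))

lemma SlabSmooth.iterate_twistLap (hG : SlabSmooth G) (c : ℝ) (j : ℕ) :
    SlabSmooth ((_root_.twistLap c)^[j] G) := by
  induction j with
  | zero => exact hG
  | succ j ih =>
    rw [Function.iterate_succ_apply']
    exact ih.twistLap c

lemma SlabSmooth.twistPow (hG : SlabSmooth G) (c : ℝ) (k : ℕ) : SlabSmooth (twistPow c k G) := by
  unfold _root_.twistPow
  split_ifs
  · exact hG.iterate_twistLap c _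
  · exact (hG.iterate_twistLap c _).twistGrad c

lemma twistGrad_zero_left (c : ℝ) (G : ℝ × ℝ → ℝ) (s : ℝ) :
    twistGrad c G (0, s) = -c * G (0, s) := by
  simp [twistGrad]

lemma iterate_twistLap_zero_left (c : ℝ) (G : ℝ × ℝ → ℝ) (j : ℕ) (s : ℝ) :
    (twistLap c)^[j] G (0, s) = (-c ^ 2) ^ j * G (0, s) := by
  induction j with
  | zero => simp
  | succ j ih =>
    rw [Function.iterate_succ_apply', twistLap]
    simp only [twistGrad_zero_left, cothRatio_zero_left, ih]
    ring

lemma twistPow_zero_left_sq (c : ℝ) (k : ℕ) (G : ℝ × ℝ → ℝ) (s : ℝ) :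
    twistPow c k G (0, s) ^ 2 = c ^ (2 * k) * G (0, s) ^ 2 := by
  unfold twistPow
  split_ifs with h
  · obtain ⟨j, rfl⟩ := h
    rw [iterate_twistLap_zero_left, show (j + j) / 2 = j by omega, mul_pow, ← pow_mul, mul_comm j 2,
      pow_mul (-c ^ 2), neg_sq]
    ring
  · obtain ⟨j, rfl⟩ := Nat.not_even_iff_odd.1 h
    rw [twistGrad_zero_left, iterate_twistLap_zero_left, show (2 * j + 1) / 2 = j by omega,
      mul_pow, mul_pow, ← pow_mul, mul_comm j 2, pow_mul (-c ^ 2), neg_sq, neg_sq]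
    ring

/-- The function `e^{-cr} G (ε, εr)`. -/
def dampedDilation (c ε : ℝ) (G : ℝ × ℝ → ℝ) (r : ℝ) : ℝ := Real.exp (-c * r) * G (ε, ε * r)

lemma SlabSmooth.deriv_dampedDilation (hG : SlabSmooth G) (c ε : ℝ) :
    deriv (dampedDilation c ε G) = dampedDilation c ε (_root_.twistGrad c G) := by
  funext r
  have h1 : HasDerivAt (fun r : ℝ => Real.exp (-c * r)) (Real.exp (-c * r) * (-c * 1)) r :=
    ((hasDerivAt_id r).const_mul (-c)).exp
  have h2 : HasDerivAt (fun r => G (ε, ε * r)) (fderiv ℝ G (ε, ε * r) (0, 1) * (ε * 1)) r :=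
    (hG.hasDerivAt_snd (ε, ε * r)).comp r ((hasDerivAt_id r).const_mul ε)
  have h := (h1.mul h2).deriv
  rw [← (hG.hasDerivAt_snd (ε, ε * r)).deriv] at h
  refine Eq.trans h ?_
  simp only [dampedDilation, _root_.twistGrad]
  ring

variable {N : ℕ} {ε : ℝ}

lemma SlabSmooth.radGrad_dampedDilation (hG : SlabSmooth G) (c ε : ℝ) :
    radGrad N (fun r _ => dampedDilation c ε G r) =
      fun r _ => dampedDilation c ε (_root_.twistGrad c G) r := by
  funext r _
  exact congrFun (hG.deriv_dampedDilation c ε) r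

lemma SlabSmooth.radLap_dampedDilation (hG : SlabSmooth G) (hε : 0 < ε) :
    radLap N (fun r _ => dampedDilation (((N : ℝ) - 1) / 2) ε G r) =
      fun r _ => dampedDilation (((N : ℝ) - 1) / 2) ε (_root_.twistLap (((N : ℝ) - 1) / 2) G) r := by
  set c : ℝ := ((N : ℝ) - 1) / 2 with hc
  have hN : (N : ℝ) - 1 = 2 * c := by rw [hc]; ring
  funext r _
  change deriv (deriv (dampedDilation c ε G)) r
    + ((N : ℝ) - 1) * (Real.cosh r / Real.sinh r) * deriv (dampedDilation c ε G) r = _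
  rw [hG.deriv_dampedDilation, (hG.twistGrad c).deriv_dampedDilation, hN]
  simp only [dampedDilation, _root_.twistLap]
  rcases le_or_gt r 0 with hr | hr
  · have hs : (ε, ε * r).2 ∉ Icc (1 : ℝ) 2 := fun h =>
      absurd h.1 (not_le.2 ((mul_nonpos_of_nonneg_of_nonpos hε.le hr).trans_lt one_pos))
    rw [(hG.twistGrad c).eq_zero _ hs]
    ring
  · rw [cothRatio_mul hε hr]
    ring

lemma SlabSmooth.radPow_dampedDilation (hG : SlabSmooth G) (hε : 0 < ε) (k : ℕ) :
    radPow N k (fun r _ => dampedDilation (((N : ℝ) - 1) / 2) ε G r) =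
      fun r _ => dampedDilation (((N : ℝ) - 1) / 2) ε
        (_root_.twistPow (((N : ℝ) - 1) / 2) k G) r := by
  have hiter : ∀ j : ℕ, (radLap N)^[j] (fun r _ => dampedDilation (((N : ℝ) - 1) / 2) ε G r) =
      fun r _ => dampedDilation (((N : ℝ) - 1) / 2) ε
        ((_root_.twistLap (((N : ℝ) - 1) / 2))^[j] G) r := by
    intro j
    induction j with
    | zero => rfl
    | succ j ih =>
      rw [Function.iterate_succ_apply', Function.iterate_succ_apply', ih]
      exact (hG.iterate_twistLap _ j).radLap_dampedDilation hε
  unfold radPow _root_.twistPow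
  split_ifs
  · exact hiter _
  · rw [hiter]
    exact (hG.iterate_twistLap _ _).radGrad_dampedDilation _ _

/-- The integral of `e^{2cr} |∇_r^k u|²` in the rescaled variable, up to a power of two. -/
def slabEnergy (N : ℕ) (G : ℝ × ℝ → ℝ) (ε : ℝ) : ℝ :=
  ∫ s in (0 : ℝ)..3, (1 - expDecay (ε, s)) ^ (N - 1) * G (ε, s) ^ 2

lemma SlabSmooth.weighted_sq (hG : SlabSmooth G) (m : ℕ) :
    SlabSmooth fun p => (1 - expDecay p) ^ m * G p ^ 2 := by
  simp only [sq, ← mul_assoc]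
  exact hG.mul_left fun p hp =>
    ((contDiffAt_const.sub (contDiffAt_expDecay hp)).pow m).mul hG.contDiff.contDiffAt

lemma SlabSmooth.continuous_slabEnergy (hG : SlabSmooth G) (N : ℕ) :
    Continuous (slabEnergy N G) :=
  intervalIntegral.continuous_parametric_intervalIntegral_of_continuous'
    (hG.weighted_sq (N - 1)).contDiff.continuous 0 3

lemma SlabSmooth.integral_dampedDilation_sq (hG : SlabSmooth G) (hN : 1 ≤ N) (hε : 0 < ε) :
    ∫ r in Ioi (0 : ℝ), dampedDilation (((N : ℝ) - 1) / 2) ε G r ^ 2 * Real.sinh r ^ (N - 1) =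
      2⁻¹ ^ (N - 1) * ε⁻¹ * slabEnergy N G ε := by
  have hpt : ∀ r ∈ Ioi (0 : ℝ),
      dampedDilation (((N : ℝ) - 1) / 2) ε G r ^ 2 * Real.sinh r ^ (N - 1) =
      2⁻¹ ^ (N - 1) * ((1 - expDecay (ε, ε * r)) ^ (N - 1) * G (ε, ε * r) ^ 2) := by
    intro r hr
    have h1 : Real.exp (-(((N : ℝ) - 1) / 2) * r) ^ 2 = Real.exp (-r) ^ (N - 1) := by
      rw [← Real.exp_nat_mul, ← Real.exp_nat_mul, Nat.cast_sub hN]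
      congr 1
      push_cast
      ring
    have h2 : Real.exp (-r) * Real.sinh r = 2⁻¹ * (1 - Real.exp (-(2 * r))) := by
      have h3 : Real.exp (-(2 * r)) = Real.exp (-r) * Real.exp (-r) := by
        rw [← Real.exp_add]; ring_nf
      have h4 : Real.exp r * Real.exp (-r) = 1 := by rw [← Real.exp_add]; simp
      rw [Real.sinh_eq, h3]
      linear_combination 2⁻¹ * h4
    rw [expDecay_mul hε hr, ← mul_assoc, ← mul_pow, ← h2, mul_pow, ← h1, dampedDilation]
    ring
  rw [setIntegral_congr_fun measurableSet_Ioi hpt, integral_const_mul,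
    integral_comp_mul_left_Ioi (fun s => (1 - expDecay (ε, s)) ^ (N - 1) * G (ε, s) ^ 2) 0 hε,
    mul_zero, smul_eq_mul, slabEnergy, intervalIntegral.integral_of_le (by norm_num),
    setIntegral_eq_of_subset_of_forall_sdiff_eq_zero measurableSet_Ioi Ioc_subset_Ioi_self,
    mul_assoc]
  intro s hs
  refine (hG.weighted_sq (N - 1)).eq_zero (ε, s) fun h => hs.2 ⟨hs.1, ?_⟩
  exact h.2.trans (by norm_num)

lemma slabEnergy_twistPow_zero (c : ℝ) (k N : ℕ) (G : ℝ × ℝ → ℝ) :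
    slabEnergy N (twistPow c k G) 0 = c ^ (2 * k) * ∫ s in (0 : ℝ)..3, G (0, s) ^ 2 := by
  simp only [slabEnergy, expDecay_zero_left, twistPow_zero_left_sq, sub_zero, one_pow, one_mul,
    intervalIntegral.integral_const_mul]

lemma hypInt_const (N : ℕ) (f : ℝ → ℝ) :
    hypInt N (fun r _ => f r) =
      (μH[(N : ℝ) - 1]).real (Metric.sphere (0 : EuclideanSpace ℝ (Fin N)) 1) *
        ∫ r in Ioi (0 : ℝ), f r * Real.sinh r ^ (N - 1) := by
  rw [hypInt, setIntegral_const, smul_eq_mul]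

end Rescaling

/-- Sharpness of the constant `((N-1)/2)^{2(k-l)}` in the higher order radial
Poincaré inequality on `ℍ^N`. -/
theorem higher_order_radial_poincare_sharp (N k l : ℕ) (hN : 3 ≤ N) (hl : l < k)
    (Λ : ℝ) (hΛ : (((N : ℝ) - 1) / 2) ^ (2 * (k - l)) < Λ) :
    ∃ u : ℝ → EuclideanSpace ℝ (Fin N) → ℝ, IsCc N u ∧
      (∃ r : ℝ, ∃ σ ∈ Metric.sphere (0 : EuclideanSpace ℝ (Fin N)) 1,
        0 ≤ r ∧ u r σ ≠ 0) ∧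
      hypInt N (fun r σ => (radPow N k u r σ) ^ 2) <
        Λ * hypInt N (fun r σ => (radPow N l u r σ) ^ 2) := by
  set c : ℝ := ((N : ℝ) - 1) / 2 with hc
  have hc0 : 0 < c := by
    have : (3 : ℝ) ≤ N := by exact_mod_cast hN
    rw [hc]; linarith
  obtain ⟨n, rfl⟩ : ∃ n, N = n + 1 := ⟨N - 1, by omega⟩
  have hfin : Module.finrank ℝ (EuclideanSpace ℝ (Fin (n + 1))) = n + 1 := by simp
  let φ : ContDiffBump (3 / 2 : ℝ) := ⟨1 / 4, 1 / 2, by norm_num, by norm_num⟩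
  have hφsupp : ∀ s : ℝ, s ∉ Icc (1 : ℝ) 2 → φ s = 0 := by
    intro s hs
    refine φ.zero_of_le_dist ?_
    change (1 / 2 : ℝ) ≤ _
    by_contra! h
    rw [Real.dist_eq, abs_lt] at h
    exact hs ⟨by linarith, by linarith⟩
  have hφ1 : φ (3 / 2) = 1 := φ.one_of_mem_closedBall (by simp [φ.rIn_pos.le])
  have hG : SlabSmooth fun p => φ p.2 :=
    ⟨φ.contDiff.comp contDiff_snd, fun p hp => hφsupp p.2 hp⟩
  set G : ℝ × ℝ → ℝ := fun p => φ p.2 with hGdef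
  have hmass : 0 < ∫ s in (0 : ℝ)..3, G (0, s) ^ 2 := by
    refine intervalIntegral.integral_pos (by norm_num) (φ.continuous.pow 2).continuousOn
      (fun s _ => sq_nonneg _) ⟨3 / 2, by norm_num, ?_⟩
    simp [hGdef, hφ1]
  have hlim : slabEnergy (n + 1) (twistPow c k G) 0 <
      Λ * slabEnergy (n + 1) (twistPow c l G) 0 := by
    rw [slabEnergy_twistPow_zero, slabEnergy_twistPow_zero, ← mul_assoc]
    refine mul_lt_mul_of_pos_right ?_ hmass
    rw [show 2 * k = 2 * (k - l) + 2 * l by omega, pow_add]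
    exact mul_lt_mul_of_pos_right hΛ (by positivity)
  have hnear : ∀ᶠ ε in nhds (0 : ℝ), slabEnergy (n + 1) (twistPow c k G) ε <
      Λ * slabEnergy (n + 1) (twistPow c l G) ε :=
    ((hG.twistPow c k).continuous_slabEnergy _).continuousAt.eventually_lt
      (((hG.twistPow c l).continuous_slabEnergy _).const_mul Λ).continuousAt hlim
  obtain ⟨ε, hεlt, hε⟩ :=
    ((hnear.filter_mono (nhdsWithin_le_nhds (s := Ioi 0))).and self_mem_nhdsWithin).exists
  replace hε : 0 < ε := hε
  refine ⟨fun r _ => dampedDilation c ε G r, ⟨?_, 2 / ε, fun r hr σ _ => ?_⟩, ?_, ?_⟩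
  · have h1 : ContDiff ℝ (⊤ : ℕ∞) (dampedDilation c ε G) :=
      (contDiff_const.mul contDiff_id).exp.mul
        (φ.contDiff.comp (contDiff_const.mul contDiff_id))
    exact h1.comp contDiff_fst
  · have h2 : G (ε, ε * r) = 0 := by
      refine hG.eq_zero _ fun h => ?_
      rw [div_lt_iff₀' hε] at hr
      exact absurd h.2 (not_le.2 hr)
    simp [dampedDilation, h2]
  · obtain ⟨σ, hσ⟩ := exists_norm_eq (EuclideanSpace ℝ (Fin (n + 1))) zero_le_one
    refine ⟨3 / 2 / ε, σ, by simpa using hσ, by positivity, ?_⟩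
    simp only [dampedDilation, hGdef, mul_div_cancel₀ _ hε.ne', hφ1]
    positivity
  · have hM : 0 < (μH[((n + 1 : ℕ) : ℝ) - 1]).real
        (Metric.sphere (0 : EuclideanSpace ℝ (Fin (n + 1))) 1) := by
      rw [show ((n + 1 : ℕ) : ℝ) - 1 = n by push_cast; ring]
      exact ENNReal.toReal_pos (hausdorffMeasure_sphere_pos hfin).ne'
        (hausdorffMeasure_sphere_lt_top hfin).ne
    have hK : 0 < (2⁻¹ : ℝ) ^ (n + 1 - 1) * ε⁻¹ := by positivity
    rw [hG.radPow_dampedDilation hε, hG.radPow_dampedDilation hε,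
      hypInt_const, hypInt_const, (hG.twistPow _ k).integral_dampedDilation_sq (by omega) hε,
      (hG.twistPow _ l).integral_dampedDilation_sq (by omega) hε]
    rw [mul_left_comm Λ, mul_left_comm Λ]
    exact mul_lt_mul_of_pos_left (mul_lt_mul_of_pos_left hεlt hK) hM
end
end

section
/- Let N ≥ 3 and let α be a real number with 0 ≤ 2α < N + 3. Then for every u ∈ C_c^∞(ℍ^N∖{o}) one has ∫_{ℍ^N} |∇_r u|²/r^α dv ≥ ((N−2−α)²/4) ∫_{ℍ^N} u²/r^{α+2} dv + ((N−1)/2) ∫_{ℍ^N} u²/r^α dv + ((N−1)(N−3−2α)/4) ∫_{ℍ^N} g(r) u²/r^α dv, where g(r) := (r coth(r) − 1)/r², and g(r) > 0 for every r > 0. -/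
open MeasureTheory Real Set

noncomputable section

open scoped NNReal in
/-- The unit sphere of `ℝ^(n+1)` has finite `n`-dimensional Hausdorff measure: it is covered by the
radial projections of the faces of a cube. -/
theorem hausdorffMeasure_unitSphere_lt_top (n : ℕ) :
    μH[(n : ℝ)] (Metric.sphere (0 : EuclideanSpace ℝ (Fin (n + 1))) 1) < ⊤ := by
  set v : Fin (n + 1) → ℝ → (Fin n → ℝ) → EuclideanSpace ℝ (Fin (n + 1)) :=
    fun i ε x => WithLp.toLp 2 (i.insertNth ε x) with hv
  set F : Fin (n + 1) → ℝ → (Fin n → ℝ) → EuclideanSpace ℝ (Fin (n + 1)) :=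
    fun i ε x => ‖v i ε x‖⁻¹ • v i ε x with hF
  have hcover : Metric.sphere (0 : EuclideanSpace ℝ (Fin (n + 1))) 1 ⊆
      ⋃ i : Fin (n + 1), ⋃ ε ∈ ({1, -1} : Finset ℝ), F i ε '' Icc (-1) 1 := by
    intro σ hσ
    have hσ1 : ‖σ‖ = 1 := by simpa using hσ
    obtain ⟨i, hi⟩ := Finite.exists_max fun i => |σ i|
    have hpos : 0 < |σ i| := by
      by_contra h
      have h0 : σ = 0 := by
        ext j
        have := hi j
        have h1 : |σ j| ≤ 0 := this.trans (not_lt.1 h)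
        simpa using h1
      simp [h0] at hσ1
    have hvσ : v i (σ i / |σ i|) (fun j => σ (i.succAbove j) / |σ i|) = |σ i|⁻¹ • σ := by
      ext j
      refine Fin.succAboveCases i ?_ (fun j => ?_) j <;> simp [hv, div_eq_inv_mul]
    simp only [mem_iUnion]
    refine ⟨i, σ i / |σ i|, ?_, fun j => σ (i.succAbove j) / |σ i|, ?_, ?_⟩
    · have : σ i ≠ 0 := abs_pos.1 hpos
      rcases abs_choice (σ i) with h | h <;> simp [h, this]
    · have hj : ∀ j, abs (σ (i.succAbove j) / |σ i|) ≤ 1 := fun j => by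
        rw [abs_div, abs_abs, div_le_one hpos]
        exact hi _
      exact ⟨fun j => (abs_le.1 (hj j)).1, fun j => (abs_le.1 (hj j)).2⟩
    · simp only [hF, hvσ, norm_smul, hσ1, norm_inv, Real.norm_eq_abs, abs_abs, mul_one, inv_inv,
        smul_smul, mul_inv_cancel₀ hpos.ne', one_smul]
  refine (measure_mono hcover).trans_lt ?_
  refine (measure_iUnion_fintype_le _ _).trans_lt (ENNReal.sum_lt_top.2 fun i _ => ?_)
  refine (measure_biUnion_finset_le _ _).trans_lt (ENNReal.sum_lt_top.2 fun ε hε => ?_)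
  have hε0 : ε ≠ 0 := by
    rcases (by simpa using hε : ε = 1 ∨ ε = -1) with rfl | rfl <;> norm_num
  have hv0 : ∀ x, v i ε x ≠ 0 := fun x h => hε0 <| by
    have := congrArg (fun y : EuclideanSpace ℝ (Fin (n + 1)) => y i) h
    simpa [hv] using this
  have hvs : ContDiff ℝ 1 (v i ε) := by
    rw [contDiff_euclidean]
    intro j
    refine Fin.succAboveCases i ?_ (fun j => ?_) j
    · simpa [hv] using contDiff_const
    · simpa [hv] using contDiff_apply ℝ ℝ j
  have hFs : ContDiff ℝ 1 (F i ε) :=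
    ((hvs.norm ℝ hv0).inv fun x => norm_ne_zero_iff.2 (hv0 x)).smul hvs
  obtain ⟨K, hK⟩ := hFs.contDiffOn.exists_lipschitzOnWith one_ne_zero
    (convex_Icc (-1 : Fin n → ℝ) 1) isCompact_Icc
  refine (hK.hausdorffMeasure_image_le n.cast_nonneg).trans_lt ?_
  have hvol : (μH[(n : ℝ)] : Measure (Fin n → ℝ)) = volume := by
    simpa using hausdorffMeasure_pi_real (ι := Fin n)
  rw [hvol]
  exact ENNReal.mul_lt_top (ENNReal.rpow_lt_top_of_nonneg n.cast_nonneg ENNReal.coe_ne_top)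
    isCompact_Icc.measure_lt_top

theorem integrable_linearCombination_and_integral {X : Type*} [MeasurableSpace X] {μ : Measure X}
    {f g h : X → ℝ} (hf : Integrable f μ) (hg : Integrable g μ) (hh : Integrable h μ)
    (p q r : ℝ) :
    Integrable (fun x => p * f x + q * g x + r * h x) μ ∧
      ∫ x, (p * f x + q * g x + r * h x) ∂μ =
        p * ∫ x, f x ∂μ + q * ∫ x, g x ∂μ + r * ∫ x, h x ∂μ := by
  have h1 := hf.const_mul p
  have h2 := hg.const_mul q
  have h3 := hh.const_mul r
  have h12 : Integrable (fun x => p * f x + q * g x) μ := h1.add h2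
  refine ⟨h12.add h3, ?_⟩
  rw [integral_add h12 h3, integral_add h1 h2, integral_const_mul, integral_const_mul,
    integral_const_mul]

/-- Radial slices and spherical averages of a continuous function supported in an annulus are
integrable. -/
theorem integrableOn_of_support_annulus {N : ℕ} (hN : 1 ≤ N)
    {F : ℝ → EuclideanSpace ℝ (Fin N) → ℝ} {a b : ℝ} (ha : 0 < a)
    (hF : ContinuousOn (Function.uncurry F) (Ioi 0 ×ˢ univ))
    (hF0 : ∀ r ∉ Icc a b, ∀ σ ∈ Metric.sphere (0 : EuclideanSpace ℝ (Fin N)) 1, F r σ = 0) :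
    (∀ σ ∈ Metric.sphere (0 : EuclideanSpace ℝ (Fin N)) 1,
      IntegrableOn (fun r => F r σ) (Ioi 0)) ∧
    IntegrableOn (fun σ => ∫ r in Ioi (0 : ℝ), F r σ)
      (Metric.sphere (0 : EuclideanSpace ℝ (Fin N)) 1) μH[(N : ℝ) - 1] := by
  have hsub : Icc a b ⊆ Ioi (0 : ℝ) := fun r hr => ha.trans_le hr.1
  refine ⟨fun σ hσ => ?_, ?_⟩
  · have h1 : IntegrableOn (fun r => F r σ) (Icc a b) := by
      refine ContinuousOn.integrableOn_Icc ?_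
      exact hF.comp (f := fun r : ℝ => (r, σ)) (by fun_prop) fun r hr => ⟨hsub hr, mem_univ _⟩
    exact h1.of_forall_sdiff_eq_zero measurableSet_Ioi fun r hr => hF0 r hr.2 σ hσ
  · have hG : Continuous (Function.uncurry fun σ r => F (max r a) σ) :=
      hF.comp_continuous (f := fun p : EuclideanSpace ℝ (Fin N) × ℝ => (max p.2 a, p.1))
        (by fun_prop) fun p => ⟨ha.trans_le (le_max_right _ _), mem_univ _⟩
    have hcont : Continuous fun σ => ∫ r in Icc a b, F (max r a) σ :=
      continuous_parametric_integral_of_continuous hG isCompact_Icc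
    obtain ⟨n, rfl⟩ : ∃ n, N = n + 1 := ⟨N - 1, by omega⟩
    have hfin : μH[((n + 1 : ℕ) : ℝ) - 1]
        (Metric.sphere (0 : EuclideanSpace ℝ (Fin (n + 1))) 1) < ⊤ := by
      simpa using hausdorffMeasure_unitSphere_lt_top n
    have hint := hcont.continuousOn.integrableOn_of_subset_isCompact
      (μ := μH[((n + 1 : ℕ) : ℝ) - 1]) (isCompact_sphere (0 : EuclideanSpace ℝ (Fin (n + 1))) 1)
      Metric.isClosed_sphere.measurableSet subset_rfl hfin.ne
    refine hint.congr_fun (fun σ hσ => ?_) Metric.isClosed_sphere.measurableSet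
    dsimp only
    rw [setIntegral_eq_of_subset_of_forall_sdiff_eq_zero measurableSet_Ioi hsub
      fun r hr => hF0 r hr.2 σ hσ]
    exact setIntegral_congr_fun measurableSet_Icc fun r hr => by
      simp only [max_eq_left hr.1]

/-- `r coth r > 1` for `r > 0`. -/
theorem one_lt_mul_cosh_div_sinh {r : ℝ} (hr : 0 < r) : 1 < r * (cosh r / sinh r) := by
  have hmono : StrictMonoOn (fun x : ℝ => x * cosh x - sinh x) (Ici 0) := by
    refine strictMonoOn_of_deriv_pos (convex_Ici 0) (by fun_prop) fun x hx => ?_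
    have hx : 0 < x := by simpa using hx
    have hd : HasDerivAt (fun x : ℝ => x * cosh x - sinh x)
        (1 * cosh x + x * sinh x - cosh x) x :=
      ((hasDerivAt_id x).mul (hasDerivAt_cosh x)).sub (hasDerivAt_sinh x)
    rw [hd.deriv]
    have := mul_pos hx (sinh_pos_iff.2 hx)
    linarith
  have h := hmono (mem_Ici.2 le_rfl) (mem_Ici.2 hr.le) hr
  simp only [zero_mul, sinh_zero, sub_zero] at h
  rw [← mul_div_assoc, one_lt_div (sinh_pos_iff.2 hr)]
  linarith

/-- The logarithmic derivative of the ground state `r^((α+1)/2) (sinh r)^(-k/2)`. -/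
def groundStateLogDeriv (k : ℕ) (α r : ℝ) : ℝ :=
  (α + 1) / 2 / r - k / 2 * (cosh r / sinh r)

/-- The derivative of `f² h (sinh r)^k / r^α`, with `h` the ground state logarithmic derivative,
for `f r = x` and `f' r = y`. -/
def groundStateDivergence (k : ℕ) (α r x y : ℝ) : ℝ :=
  sinh r ^ k / r ^ α * (2 * x * y * groundStateLogDeriv k α r + x ^ 2 *
    (-((α + 1) / 2 / r ^ 2) + k / 2 / sinh r ^ 2 +
      groundStateLogDeriv k α r * (k * (cosh r / sinh r) - α / r)))

theorem hasDerivAt_groundState_flux (k : ℕ) (α : ℝ) {f : ℝ → ℝ} {f' r : ℝ} (hr : 0 < r)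
    (hf : HasDerivAt f f' r) :
    HasDerivAt (fun s => sinh s ^ k / s ^ α * (f s ^ 2 * groundStateLogDeriv k α s))
      (groundStateDivergence k α r (f r) f') r := by
  have hS : sinh r ≠ 0 := (sinh_pos_iff.2 hr).ne'
  have hA : r ^ α ≠ 0 := (rpow_pos_of_pos hr α).ne'
  have hcs : cosh r ^ 2 = sinh r ^ 2 + 1 := cosh_sq r
  have hh : HasDerivAt (groundStateLogDeriv k α)
      (-((α + 1) / 2 / r ^ 2) + k / 2 / sinh r ^ 2) r := by
    have h1 := ((hasDerivAt_const r ((α + 1) / 2)).div (hasDerivAt_id r) hr.ne').sub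
      (((hasDerivAt_cosh r).div (hasDerivAt_sinh r) hS).const_mul ((k : ℝ) / 2))
    refine h1.congr_deriv ?_
    simp only [id]
    field_simp
    linear_combination (-(k : ℝ) * r ^ 2) * (-hcs)
  have hW : HasDerivAt (fun s => sinh s ^ k / s ^ α)
      (sinh r ^ k / r ^ α * (k * (cosh r / sinh r) - α / r)) r := by
    have h1 := ((hasDerivAt_sinh r).pow k).div (hasDerivAt_rpow_const (p := α) (Or.inl hr.ne')) hA
    refine h1.congr_deriv ?_
    rw [rpow_sub_one hr.ne']
    rcases k with _ | k
    · field_simp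
      simp
    · simp only [Nat.add_sub_cancel, Pi.pow_apply, pow_succ]
      field_simp
  refine (hW.mul ((hf.pow 2).mul hh)).congr_deriv ?_
  simp only [groundStateDivergence, Pi.pow_apply, Pi.mul_apply]
  push_cast
  ring

theorem groundStateDivergence_le {k : ℕ} (hk : 2 ≤ k) (α x y : ℝ) {r : ℝ} (hr : 0 < r) :
    groundStateDivergence k α r x y ≤
      y ^ 2 / r ^ α * sinh r ^ k -
        (((k : ℝ) - 1 - α) ^ 2 / 4 * (x ^ 2 / r ^ (α + 2) * sinh r ^ k)
        + (k : ℝ) / 2 * (x ^ 2 / r ^ α * sinh r ^ k)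
        + (k : ℝ) * ((k : ℝ) - 2 - 2 * α) / 4 *
          ((r * (cosh r / sinh r) - 1) / r ^ 2 * x ^ 2 / r ^ α * sinh r ^ k)) := by
  have hS : 0 < sinh r := sinh_pos_iff.2 hr
  have hA : 0 < r ^ α := rpow_pos_of_pos hr α
  have hA2 : r ^ (α + 2) = r ^ α * r ^ 2 := by
    rw [rpow_add hr]; norm_cast
  have hk' : (2 : ℝ) ≤ k := by exact_mod_cast hk
  have hg := one_lt_mul_cosh_div_sinh hr
  have hrem : 0 ≤ sinh r ^ k / r ^ α * ((y - groundStateLogDeriv k α r * x) ^ 2 +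
      (k : ℝ) * (k - 2) / 4 * (cosh r / sinh r) * ((r * (cosh r / sinh r) - 1) / r) * x ^ 2) := by
    have h1 : 0 ≤ (r * (cosh r / sinh r) - 1) / r := div_nonneg (by linarith) hr.le
    have h2 : (0 : ℝ) ≤ k - 2 := by linarith
    have h3 := cosh_pos r
    positivity
  rw [← sub_nonneg]
  refine hrem.trans_eq ?_
  rw [hA2]
  unfold groundStateDivergence groundStateLogDeriv
  have hi : 1 / sinh r ^ 2 = (cosh r / sinh r) ^ 2 - 1 := by
    field_simp
    linarith [cosh_sq r]
  have hi' : (k : ℝ) / 2 / sinh r ^ 2 = k / 2 * ((cosh r / sinh r) ^ 2 - 1) := by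
    rw [← hi]; ring
  rw [hi']
  generalize cosh r / sinh r = c
  field_simp
  ring

/-- The weighted Hardy inequality along a single ray. -/
theorem setIntegral_hardy_remainder_nonneg {k : ℕ} (hk : 2 ≤ k) (α : ℝ) {f : ℝ → ℝ}
    (hf : ContDiff ℝ 1 f) {a b : ℝ} (ha : 0 < a) (hab : a ≤ b) (hf0 : ∀ r ∉ Icc a b, f r = 0) :
    0 ≤ ∫ r in Ioi (0 : ℝ), (deriv f r ^ 2 / r ^ α * sinh r ^ k -
        (((k : ℝ) - 1 - α) ^ 2 / 4 * (f r ^ 2 / r ^ (α + 2) * sinh r ^ k)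
        + (k : ℝ) / 2 * (f r ^ 2 / r ^ α * sinh r ^ k)
        + (k : ℝ) * ((k : ℝ) - 2 - 2 * α) / 4 *
          ((r * (cosh r / sinh r) - 1) / r ^ 2 * f r ^ 2 / r ^ α * sinh r ^ k))) := by
  have hd0 : ∀ r ∉ Icc a b, deriv f r = 0 := fun r hr => by
    have : f =ᶠ[nhds r] fun _ => 0 := by
      filter_upwards [isClosed_Icc.isOpen_compl.mem_nhds hr] with s hs using hf0 s hs
    rw [this.deriv_eq, deriv_const]
  have hle : a / 2 ≤ b + 1 := by linarith
  have hsub : Icc (a / 2) (b + 1) ⊆ Ioi (0 : ℝ) := fun r hr => (half_pos ha).trans_le hr.1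
  rw [setIntegral_eq_of_subset_of_forall_sdiff_eq_zero measurableSet_Ioi hsub,
    integral_Icc_eq_integral_Ioc, ← intervalIntegral.integral_of_le hle]
  swap
  · intro r hr
    have hr' : r ∉ Icc a b := fun h => hr.2 ⟨by linarith [h.1], by linarith [h.2]⟩
    simp [hf0 r hr', hd0 r hr']
  have hr0 : ∀ r ∈ Icc (a / 2) (b + 1), r ≠ 0 := fun r hr => (hsub hr).ne'
  have hS0 : ∀ r ∈ Icc (a / 2) (b + 1), sinh r ≠ 0 := fun r hr => (sinh_pos_iff.2 (hsub hr)).ne'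
  have hA0 : ∀ β : ℝ, ∀ r ∈ Icc (a / 2) (b + 1), r ^ β ≠ 0 := fun β r hr =>
    (rpow_pos_of_pos (hsub hr) β).ne'
  have hAc : ∀ β : ℝ, ContinuousOn (fun r : ℝ => r ^ β) (Icc (a / 2) (b + 1)) := fun β =>
    continuousOn_id.rpow_const fun r hr => Or.inl (hr0 r hr)
  have hr2 : ∀ r ∈ Icc (a / 2) (b + 1), r ^ 2 ≠ 0 := fun r hr => pow_ne_zero 2 (hr0 r hr)
  have hS2 : ∀ r ∈ Icc (a / 2) (b + 1), sinh r ^ 2 ≠ 0 := fun r hr => pow_ne_zero 2 (hS0 r hr)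
  have hfc : Continuous f := hf.continuous
  have hdc : Continuous (deriv f) := hf.continuous_deriv le_rfl
  have hPc : ContinuousOn (fun r => groundStateDivergence k α r (f r) (deriv f r))
      (Icc (a / 2) (b + 1)) := by
    unfold groundStateDivergence groundStateLogDeriv
    have := hAc α
    have := hA0 α
    fun_prop (disch := assumption)
  have hP : ∫ r in (a / 2)..(b + 1), groundStateDivergence k α r (f r) (deriv f r) = 0 := by
    rw [intervalIntegral.integral_eq_sub_of_hasDerivAt
      (f := fun s => sinh s ^ k / s ^ α * (f s ^ 2 * groundStateLogDeriv k α s))]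
    · have h1 : f (a / 2) = 0 := hf0 _ fun h => by linarith [h.1]
      have h2 : f (b + 1) = 0 := hf0 _ fun h => by linarith [h.2]
      simp [h1, h2]
    · intro r hr
      rw [uIcc_of_le hle] at hr
      exact hasDerivAt_groundState_flux k α (hsub hr)
        (hf.differentiable one_ne_zero r).hasDerivAt
    · exact (hPc.mono (uIcc_of_le hle).subset).intervalIntegrable
  rw [← hP]
  refine intervalIntegral.integral_mono_on hle
    (hPc.mono (uIcc_of_le hle).subset).intervalIntegrable ?_
    fun r hr => groundStateDivergence_le hk α (f r) (deriv f r) (hsub hr)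
  refine ContinuousOn.intervalIntegrable ?_
  rw [uIcc_of_le hle]
  have := hAc α
  have := hA0 α
  have := hAc (α + 2)
  have := hA0 (α + 2)
  fun_prop (disch := assumption)

/-- Weighted Hardy inequality with radial derivative and remainder terms on `ℍ^N`,
where `g(r) = (r coth r - 1)/r²` is a positive function. -/
theorem weighted_radial_hardy_with_remainder (N : ℕ) (hN : 3 ≤ N) (α : ℝ)
    (hα0 : 0 ≤ 2 * α) (hα : 2 * α < (N : ℝ) + 3)
    (u : ℝ → EuclideanSpace ℝ (Fin N) → ℝ) (hu : IsCcAway N u) :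
    (∀ r : ℝ, 0 < r → 0 < (r * (Real.cosh r / Real.sinh r) - 1) / r ^ 2) ∧
    hypInt N (fun r σ => (radGrad N u r σ) ^ 2 / r ^ α) ≥
      (((N : ℝ) - 2 - α) ^ 2 / 4) * hypInt N (fun r σ => (u r σ) ^ 2 / r ^ (α + 2))
      + (((N : ℝ) - 1) / 2) * hypInt N (fun r σ => (u r σ) ^ 2 / r ^ α)
      + (((N : ℝ) - 1) * ((N : ℝ) - 3 - 2 * α) / 4) *
          hypInt N (fun r σ =>
            ((r * (Real.cosh r / Real.sinh r) - 1) / r ^ 2) * (u r σ) ^ 2 / r ^ α) := by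
  obtain ⟨hsm, a, b, ha, hab, hu0⟩ := hu
  refine ⟨fun r hr => div_pos (by linarith [one_lt_mul_cosh_div_sinh hr]) (by positivity), ?_⟩
  set S := Metric.sphere (0 : EuclideanSpace ℝ (Fin N)) 1 with hS
  have hslice : ∀ σ, ContDiff ℝ 1 fun r => u r σ := fun σ =>
    (hsm.of_le (by exact_mod_cast le_top)).comp (contDiff_id.prodMk contDiff_const)
  have hd0 : ∀ r ∉ Icc a b, ∀ σ ∈ S, radGrad N u r σ = 0 := fun r hr σ hσ => by
    have : (fun s => u s σ) =ᶠ[nhds r] fun _ => 0 := by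
      filter_upwards [isClosed_Icc.isOpen_compl.mem_nhds hr] with s hs using hu0 s hs σ hσ
    rw [radGrad, this.deriv_eq, deriv_const]
  have huc : Continuous (Function.uncurry u) := hsm.continuous
  have hdc : Continuous (Function.uncurry (radGrad N u)) := by
    have h : Function.uncurry (radGrad N u) =
        fun p => fderiv ℝ (Function.uncurry u) p (1, 0) := by
      ext ⟨r, σ⟩
      have h1 := (hsm.differentiable (by simp) (r, σ)).hasFDerivAt.comp_hasDerivAt r
        ((hasDerivAt_id r).prodMk (hasDerivAt_const r σ))
      exact h1.deriv
    rw [h]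
    exact (hsm.continuous_fderiv (by simp)).clm_apply continuous_const
  have hT0 : ∀ p ∈ Ioi (0 : ℝ) ×ˢ (univ : Set (EuclideanSpace ℝ (Fin N))), p.1 ≠ 0 :=
    fun p hp => ne_of_gt hp.1
  have hT2 : ∀ p ∈ Ioi (0 : ℝ) ×ˢ (univ : Set (EuclideanSpace ℝ (Fin N))), p.1 ^ 2 ≠ 0 :=
    fun p hp => pow_ne_zero 2 (hT0 p hp)
  have hTS : ∀ p ∈ Ioi (0 : ℝ) ×ˢ (univ : Set (EuclideanSpace ℝ (Fin N))), sinh p.1 ≠ 0 :=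
    fun p hp => (sinh_pos_iff.2 hp.1).ne'
  have hTA : ∀ β : ℝ, ∀ p ∈ Ioi (0 : ℝ) ×ˢ (univ : Set (EuclideanSpace ℝ (Fin N))),
      p.1 ^ β ≠ 0 := fun β p hp => (rpow_pos_of_pos hp.1 β).ne'
  have hAc : ∀ β : ℝ, ContinuousOn (fun p : ℝ × EuclideanSpace ℝ (Fin N) => p.1 ^ β)
      (Ioi (0 : ℝ) ×ˢ univ) := fun β =>
    continuousOn_fst.rpow_const fun p hp => Or.inl (hT0 p hp)
  have hA1 := hAc α
  have hA2 := hTA α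
  have hA3 := hAc (α + 2)
  have hA4 := hTA (α + 2)
  have huc' : Continuous fun p : ℝ × EuclideanSpace ℝ (Fin N) => u p.1 p.2 := huc
  have hdc' : Continuous fun p : ℝ × EuclideanSpace ℝ (Fin N) => radGrad N u p.1 p.2 := hdc
  have hN1 : 1 ≤ N := by omega
  obtain ⟨i1, j1⟩ := integrableOn_of_support_annulus (b := b) hN1
    (F := fun r σ => radGrad N u r σ ^ 2 / r ^ α * sinh r ^ (N - 1)) ha
    (by unfold Function.uncurry; fun_prop (disch := assumption))
    (fun r hr σ hσ => by simp [hd0 r hr σ hσ])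
  obtain ⟨i2, j2⟩ := integrableOn_of_support_annulus (b := b) hN1
    (F := fun r σ => u r σ ^ 2 / r ^ (α + 2) * sinh r ^ (N - 1)) ha
    (by unfold Function.uncurry; fun_prop (disch := assumption))
    (fun r hr σ hσ => by simp [hu0 r hr σ hσ])
  obtain ⟨i3, j3⟩ := integrableOn_of_support_annulus (b := b) hN1
    (F := fun r σ => u r σ ^ 2 / r ^ α * sinh r ^ (N - 1)) ha
    (by unfold Function.uncurry; fun_prop (disch := assumption))
    (fun r hr σ hσ => by simp [hu0 r hr σ hσ])
  obtain ⟨i4, j4⟩ := integrableOn_of_support_annulus (b := b) hN1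
    (F := fun r σ => (r * (cosh r / sinh r) - 1) / r ^ 2 * u r σ ^ 2 / r ^ α * sinh r ^ (N - 1)) ha
    (by unfold Function.uncurry; fun_prop (disch := assumption))
    (fun r hr σ hσ => by simp [hu0 r hr σ hσ])
  have hk : ((N - 1 : ℕ) : ℝ) = (N : ℝ) - 1 := by push_cast [hN1]; ring
  obtain ⟨jint, jeq⟩ := integrable_linearCombination_and_integral j2 j3 j4
    (((N : ℝ) - 2 - α) ^ 2 / 4) (((N : ℝ) - 1) / 2) (((N : ℝ) - 1) * ((N : ℝ) - 3 - 2 * α) / 4)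
  unfold hypInt
  refine jeq.symm.trans_le ?_
  refine setIntegral_mono_on jint j1 Metric.isClosed_sphere.measurableSet fun σ hσ => ?_
  obtain ⟨iint, ieq⟩ := integrable_linearCombination_and_integral (i2 σ hσ) (i3 σ hσ) (i4 σ hσ)
    (((N : ℝ) - 2 - α) ^ 2 / 4) (((N : ℝ) - 1) / 2) (((N : ℝ) - 1) * ((N : ℝ) - 3 - 2 * α) / 4)
  have key := setIntegral_hardy_remainder_nonneg (k := N - 1) (by omega) α (hslice σ) ha hab
    fun r hr => hu0 r hr σ hσ
  rw [hk, show (N : ℝ) - 1 - 1 = N - 2 by ring, show (N : ℝ) - 1 - 2 = N - 3 by ring] at key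
  rw [← ieq, ← sub_nonneg, ← integral_sub (i1 σ hσ) iint]
  exact key
end
end

section
/- Let N ≥ 3 and let α be a real number with 0 ≤ 2α ≤ N − 3. Then for every u ∈ C_c^∞(ℍ^N∖{o}) one has ∫_{ℍ^N} |∇_r u|²/r^α dv ≥ ((N−2−α)²/4) ∫_{ℍ^N} u²/r^{α+2} dv + ((N−1)/2) ∫_{ℍ^N} u²/r^α dv. -/
open MeasureTheory Real Set

noncomputable section

theorem sinh_le_mul_cosh {r : ℝ} (hr : 0 ≤ r) : sinh r ≤ r * cosh r := by
  have hmono : MonotoneOn (fun x : ℝ => x * cosh x - sinh x) (Ici 0) := by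
    refine monotoneOn_of_deriv_nonneg (convex_Ici 0) (by fun_prop) (by fun_prop) fun x hx => ?_
    rw [interior_Ici, mem_Ioi] at hx
    have h : HasDerivAt (fun x : ℝ => x * cosh x - sinh x) (1 * cosh x + x * sinh x - cosh x) x :=
      ((hasDerivAt_id x).mul (hasDerivAt_cosh x)).sub (hasDerivAt_sinh x)
    rw [h.deriv]
    have := mul_nonneg hx.le (sinh_nonneg_iff.2 hx.le)
    linarith
  have := hmono self_mem_Ici hr hr
  simp only [zero_mul, sinh_zero, sub_zero] at this
  linarith

theorem hasDerivAt_hardy_weight {k : ℕ} {α r : ℝ} (hr : 0 < r) :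
    HasDerivAt (fun x : ℝ => x ^ (-α) * sinh x ^ k)
      (r ^ (-α) * sinh r ^ k * (k * (cosh r / sinh r) - α / r)) r := by
  have hs : 0 < sinh r := sinh_pos_iff.2 hr
  refine ((hasDerivAt_rpow_const (p := -α) (Or.inl hr.ne')).mul
    ((hasDerivAt_sinh r).pow k)).congr_deriv ?_
  rw [rpow_sub_one hr.ne']
  rcases k with _ | k
  · simp; ring
  · simp only [Nat.add_sub_cancel, pow_succ, Pi.pow_apply]
    push_cast
    field_simp
    ring

theorem hasDerivAt_hardy_potential {k : ℕ} {α r : ℝ} (hr : 0 < r) :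
    HasDerivAt (fun x : ℝ => k / 2 * (cosh x / sinh x) - (1 + α) / 2 * x⁻¹)
      (-(k / 2 * (1 / sinh r ^ 2)) + (1 + α) / (2 * r ^ 2)) r := by
  have hs : 0 < sinh r := sinh_pos_iff.2 hr
  refine ((((hasDerivAt_cosh r).div (hasDerivAt_sinh r) hs.ne').const_mul ((k : ℝ) / 2)).sub
    ((hasDerivAt_inv hr.ne').const_mul ((1 + α) / 2))).congr_deriv ?_
  have := cosh_sq r
  field_simp
  linear_combination (-(k : ℝ) * r ^ 2) * this

theorem hardy_riccati {k : ℕ} {α r : ℝ} (hα0 : 0 ≤ 2 * α) (hα : 2 * α ≤ (k : ℝ) - 2)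
    (hr : 0 < r) :
    ((k : ℝ) - 1 - α) ^ 2 / 4 / r ^ 2 + (k : ℝ) / 2 ≤
      -(k / 2 * (1 / sinh r ^ 2)) + (1 + α) / (2 * r ^ 2)
        + (k / 2 * (cosh r / sinh r) - (1 + α) / 2 * r⁻¹) * (k * (cosh r / sinh r) - α / r)
        - (k / 2 * (cosh r / sinh r) - (1 + α) / 2 * r⁻¹) ^ 2 := by
  have hs : 0 < sinh r := sinh_pos_iff.2 hr
  have h1 : 1 / r ≤ cosh r / sinh r := by
    rw [div_le_div_iff₀ hr hs]
    linarith [sinh_le_mul_cosh hr.le]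
  have h2 : 1 / sinh r ^ 2 = (cosh r / sinh r) ^ 2 - 1 := by
    have := cosh_sq r
    field_simp
    linarith
  have hq : 0 < 1 / r := by positivity
  have e1 : (1 + α) / (2 * r ^ 2) = (1 + α) / 2 * (1 / r) ^ 2 := by field_simp
  have e2 : ((k : ℝ) - 1 - α) ^ 2 / 4 / r ^ 2 = ((k : ℝ) - 1 - α) ^ 2 / 4 * (1 / r) ^ 2 := by
    field_simp
  have e3 : α / r = α * (1 / r) := by field_simp
  have e4 : r⁻¹ = 1 / r := by field_simp
  rw [h2, e1, e2, e3, e4]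
  generalize cosh r / sinh r = c at *
  generalize 1 / r = q at *
  have hk : (0 : ℝ) ≤ k := k.cast_nonneg
  have h3 : 0 ≤ (k : ℝ) * (((k : ℝ) - 2 - 2 * α) * (c ^ 2 - q ^ 2) + 2 * α * (c * (c - q))) := by
    have : 0 ≤ c ^ 2 - q ^ 2 := by nlinarith
    have : 0 ≤ c * (c - q) := mul_nonneg (by linarith) (by linarith)
    have : 0 ≤ (k : ℝ) - 2 - 2 * α := by linarith
    positivity
  linarith

theorem weighted_hardy_interval {k : ℕ} {α a b : ℝ} (hα0 : 0 ≤ 2 * α)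
    (hα : 2 * α ≤ (k : ℝ) - 2) (ha : 0 < a) (hab : a ≤ b) {f : ℝ → ℝ} (hf : ContDiff ℝ 1 f)
    (hfa : f a = 0) (hfb : f b = 0) :
    ((k : ℝ) - 1 - α) ^ 2 / 4 * (∫ r in a..b, f r ^ 2 / r ^ (α + 2) * sinh r ^ k)
      + (k : ℝ) / 2 * (∫ r in a..b, f r ^ 2 / r ^ α * sinh r ^ k)
      ≤ ∫ r in a..b, deriv f r ^ 2 / r ^ α * sinh r ^ k := by
  have hpos : ∀ r ∈ uIcc a b, 0 < r := fun r hr => by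
    rw [uIcc_of_le hab] at hr
    exact ha.trans_le hr.1
  have hfd : Continuous (deriv f) := hf.continuous_deriv le_rfl
  have hfc : Continuous f := hf.continuous
  have hrpow : ∀ β : ℝ, ContinuousOn (fun r : ℝ => r ^ β) (uIcc a b) := fun β =>
    continuousOn_id.rpow_const fun r hr => Or.inl (hpos r hr).ne'
  have hint : ∀ (β : ℝ) {h : ℝ → ℝ}, Continuous h →
      IntervalIntegrable (fun r => h r ^ 2 / r ^ β * sinh r ^ k) volume a b := fun β h hh =>
    (((hh.pow 2).continuousOn.div (hrpow β) fun r hr => (rpow_pos_of_pos (hpos r hr) β).ne').mul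
      (continuous_sinh.pow k).continuousOn).intervalIntegrable
  let w : ℝ → ℝ := fun r => r ^ (-α) * sinh r ^ k
  let g : ℝ → ℝ := fun r => k / 2 * (cosh r / sinh r) - (1 + α) / 2 * r⁻¹
  let g' : ℝ → ℝ := fun r => -(k / 2 * (1 / sinh r ^ 2)) + (1 + α) / (2 * r ^ 2)
  let p : ℝ → ℝ := fun r => k * (cosh r / sinh r) - α / r
  let D : ℝ → ℝ := fun r =>
    (g' r * w r + g r * (w r * p r)) * f r ^ 2 + g r * w r * (2 * f r * deriv f r)
  have hD : ∀ r ∈ uIcc a b, HasDerivAt (fun x => g x * w x * f x ^ 2) (D r) r := fun r hr => by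
    have h1 := (hf.differentiable one_ne_zero r).hasDerivAt.pow 2
    refine (((hasDerivAt_hardy_potential (k := k) (α := α) (hpos r hr)).mul
      (hasDerivAt_hardy_weight (k := k) (α := α) (hpos r hr))).mul h1).congr_deriv ?_
    simp only [D, g', g, w, p]
    norm_num
  have hDint : IntervalIntegrable D volume a b := by
    have hw : ContinuousOn w (uIcc a b) := (hrpow _).mul (continuous_sinh.pow k).continuousOn
    have hs : ∀ r ∈ uIcc a b, sinh r ≠ 0 := fun r hr => (sinh_pos_iff.2 (hpos r hr)).ne'
    have hr0 : ∀ r ∈ uIcc a b, r ≠ 0 := fun r hr => (hpos r hr).ne'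
    have hc : ContinuousOn (fun r => cosh r / sinh r) (uIcc a b) :=
      continuous_cosh.continuousOn.div continuous_sinh.continuousOn hs
    have hg : ContinuousOn g (uIcc a b) :=
      (continuousOn_const.mul hc).sub (continuousOn_const.mul (continuousOn_id.inv₀ hr0))
    have hp : ContinuousOn p (uIcc a b) :=
      (continuousOn_const.mul hc).sub (continuousOn_const.div continuousOn_id hr0)
    have hg' : ContinuousOn g' (uIcc a b) := by
      refine ContinuousOn.add (continuousOn_const.mul
        (continuousOn_const.div (continuous_sinh.pow 2).continuousOn fun r hr =>
          pow_ne_zero 2 (hs r hr))).neg (continuousOn_const.div (by fun_prop) fun r hr => ?_)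
      have := hr0 r hr
      positivity
    exact ((((hg'.mul hw).add (hg.mul (hw.mul hp))).mul (hfc.pow 2).continuousOn).add
      ((hg.mul hw).mul ((continuous_const.mul hfc).mul hfd).continuousOn)).intervalIntegrable
  have hD0 : ∫ r in a..b, D r = 0 := by
    rw [intervalIntegral.integral_eq_sub_of_hasDerivAt hD hDint]
    simp [hfa, hfb]
  calc _ = ∫ r in a..b, (((k : ℝ) - 1 - α) ^ 2 / 4 * (f r ^ 2 / r ^ (α + 2) * sinh r ^ k)
          + (k : ℝ) / 2 * (f r ^ 2 / r ^ α * sinh r ^ k)) := by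
        rw [intervalIntegral.integral_add ((hint _ hfc).const_mul _) ((hint _ hfc).const_mul _),
          intervalIntegral.integral_const_mul, intervalIntegral.integral_const_mul]
    _ ≤ ∫ r in a..b, (deriv f r ^ 2 / r ^ α * sinh r ^ k + D r) := by
        refine intervalIntegral.integral_mono_on hab
          (((hint _ hfc).const_mul _).add ((hint _ hfc).const_mul _))
          ((hint _ hfd).add hDint) fun r hr => ?_
        have hr0 : 0 < r := ha.trans_le hr.1
        have hw0 : 0 ≤ w r :=
          mul_nonneg (rpow_nonneg hr0.le _) (pow_nonneg (sinh_nonneg_iff.2 hr0.le) _)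
        have e : ∀ y : ℝ, y / r ^ α * sinh r ^ k = y * w r := fun y => by
          simp only [w, rpow_neg hr0.le]
          ring
        have e2 : f r ^ 2 / r ^ (α + 2) * sinh r ^ k = f r ^ 2 / r ^ 2 * w r := by
          rw [← e, rpow_add hr0, rpow_two, div_div, mul_comm (r ^ 2)]
        rw [e2, e, e]
        have hR : ((k : ℝ) - 1 - α) ^ 2 / 4 / r ^ 2 + (k : ℝ) / 2
            ≤ g' r + g r * p r - g r ^ 2 := hardy_riccati hα0 hα hr0
        have h1 := mul_le_mul_of_nonneg_left hR (mul_nonneg (sq_nonneg (f r)) hw0)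
        have h2 := mul_nonneg (sq_nonneg (deriv f r + g r * f r)) hw0
        simp only [D]
        linear_combination h1 + h2
    _ = _ := by
        rw [intervalIntegral.integral_add (hint _ hfd) hDint, hD0, add_zero]

theorem hausdorffMeasure_sphere_lt_top_s3 (n : ℕ) :
    μH[n] (Metric.sphere (0 : EuclideanSpace ℝ (Fin (n + 1))) 1) < ⊤ := by
  let z : Fin (n + 1) → ℝ → (Fin n → ℝ) → EuclideanSpace ℝ (Fin (n + 1)) :=
    fun i s y => WithLp.toLp 2 (i.insertNth s y)
  let φ : Fin (n + 1) → ℝ → (Fin n → ℝ) → EuclideanSpace ℝ (Fin (n + 1)) :=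
    fun i s y => ‖z i s y‖⁻¹ • z i s y
  have hz0 : ∀ i s y, s ≠ 0 → z i s y ≠ 0 := fun i s y hs h => hs <| by
    simpa [z] using congrArg (fun v : EuclideanSpace ℝ (Fin (n + 1)) => v i) h
  have hz : ∀ i s, ContDiff ℝ 1 (z i s) := fun i s => by
    refine contDiff_euclidean.2 fun j => ?_
    rcases Fin.eq_self_or_eq_succAbove i j with rfl | ⟨j, rfl⟩
    · simpa [z] using contDiff_const
    · simpa [z] using contDiff_apply ℝ ℝ j
  have hφ : ∀ i s, s ≠ 0 → ContDiff ℝ 1 (φ i s) := fun i s hs =>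
    (((hz i s).norm ℝ fun y => hz0 i s y hs).inv fun y => norm_ne_zero_iff.2 (hz0 i s y hs)).smul
      (hz i s)
  have hfin : ∀ i s, s ≠ 0 → μH[n] (φ i s '' Metric.closedBall 0 1) < ⊤ := fun i s hs => by
    obtain ⟨K, hK⟩ := (hφ i s hs).contDiffOn.exists_lipschitzOnWith one_ne_zero
      (convex_closedBall (0 : Fin n → ℝ) 1) (isCompact_closedBall _ _)
    refine (hK.hausdorffMeasure_image_le n.cast_nonneg).trans_lt ?_
    have := hausdorffMeasure_pi_real (ι := Fin n)
    rw [Fintype.card_fin] at this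
    rw [this]
    exact ENNReal.mul_lt_top (by simp) measure_closedBall_lt_top
  have hcover : Metric.sphere (0 : EuclideanSpace ℝ (Fin (n + 1))) 1 ⊆
      ⋃ i, (φ i 1 '' Metric.closedBall 0 1 ∪ φ i (-1) '' Metric.closedBall 0 1) := fun x hx => by
    have hx1 : ‖x‖ = 1 := by simpa using hx
    obtain ⟨i, hi⟩ := Finite.exists_max fun i => |x i|
    have hi0 : 0 < |x i| := by
      refine (abs_nonneg _).lt_of_ne fun h => ?_
      have : x = 0 := by
        ext j
        exact abs_nonpos_iff.1 (h ▸ hi j)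
      simp [this] at hx1
    have hmem : (fun j => x (i.succAbove j) / |x i|) ∈ Metric.closedBall (0 : Fin n → ℝ) 1 := by
      rw [mem_closedBall_zero_iff, pi_norm_le_iff_of_nonneg zero_le_one]
      intro j
      rw [Real.norm_eq_abs, abs_div, abs_abs]
      exact div_le_one_of_le₀ (hi _) hi0.le
    have hzx : ∀ s, s = x i / |x i| → φ i s (fun j => x (i.succAbove j) / |x i|) = x := by
      rintro s rfl
      have : z i (x i / |x i|) (fun j => x (i.succAbove j) / |x i|) = |x i|⁻¹ • x := by
        ext j
        rcases Fin.eq_self_or_eq_succAbove i j with rfl | ⟨j, rfl⟩ <;>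
          simp [z, div_eq_inv_mul]
      simp only [φ, this, norm_smul, hx1, smul_smul]
      simp [hi0.ne']
    refine mem_iUnion.2 ⟨i, ?_⟩
    rcases abs_cases (x i) with ⟨h, _⟩ | ⟨h, _⟩
    · exact Or.inl ⟨_, hmem, hzx 1 (by rw [h, div_self (h ▸ hi0.ne')])⟩
    · have h0 : x i ≠ 0 := abs_pos.1 hi0
      exact Or.inr ⟨_, hmem, hzx (-1) (by rw [h, div_neg, div_self h0])⟩
  refine (measure_mono hcover).trans_lt ((measure_iUnion_fintype_le _ _).trans_lt ?_)
  exact ENNReal.sum_lt_top.2 fun i _ => (measure_union_le _ _).trans_lt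
    (ENNReal.add_lt_top.2 ⟨hfin i 1 one_ne_zero, hfin i (-1) (by norm_num)⟩)

theorem hypInt_eq_of_support {N : ℕ} {F : ℝ → EuclideanSpace ℝ (Fin N) → ℝ} {a b : ℝ}
    (ha : 0 < a) (hab : a ≤ b)
    (hF : ∀ r ∉ Icc a b, ∀ σ ∈ Metric.sphere (0 : EuclideanSpace ℝ (Fin N)) 1, F r σ = 0) :
    hypInt N F = ∫ σ in Metric.sphere (0 : EuclideanSpace ℝ (Fin N)) 1,
      (∫ r in a..b, F r σ * sinh r ^ (N - 1)) ∂μH[(N : ℝ) - 1] := by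
  refine setIntegral_congr_fun Metric.isClosed_sphere.measurableSet fun σ hσ => ?_
  rw [intervalIntegral.integral_of_le hab, ← integral_Icc_eq_integral_Ioc]
  refine setIntegral_eq_of_subset_of_forall_sdiff_eq_zero measurableSet_Ioi
    (fun r hr => ha.trans_le hr.1) fun r hr => ?_
  rw [hF r hr.2 σ hσ, zero_mul]

theorem integrableOn_sphere_weighted {N : ℕ} (hN : 1 ≤ N) {a b : ℝ} (ha : 0 < a) (hab : a ≤ b)
    (β : ℝ) {h : ℝ → EuclideanSpace ℝ (Fin N) → ℝ} (hh : Continuous (Function.uncurry h)) :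
    IntegrableOn (fun σ => ∫ r in a..b, h r σ ^ 2 / r ^ β * sinh r ^ (N - 1))
      (Metric.sphere (0 : EuclideanSpace ℝ (Fin N)) 1) μH[(N : ℝ) - 1] := by
  have hcont : Continuous fun σ =>
      ∫ r in a..b, h r σ ^ 2 / max r a ^ β * sinh r ^ (N - 1) := by
    refine intervalIntegral.continuous_parametric_intervalIntegral_of_continuous' ?_ a b
    have h1 : Continuous fun x : EuclideanSpace ℝ (Fin N) × ℝ => h x.2 x.1 :=
      hh.comp continuous_swap
    have h2 : ∀ x : EuclideanSpace ℝ (Fin N) × ℝ, 0 < max x.2 a := fun x =>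
      ha.trans_le (le_max_right _ _)
    exact ((h1.pow 2).div ((continuous_snd.max continuous_const).rpow_const
      fun x => Or.inl (h2 x).ne') fun x => (rpow_pos_of_pos (h2 x) β).ne').mul
      ((continuous_sinh.comp continuous_snd).pow _)
  have heq : (fun σ => ∫ r in a..b, h r σ ^ 2 / r ^ β * sinh r ^ (N - 1)) =
      fun σ => ∫ r in a..b, h r σ ^ 2 / max r a ^ β * sinh r ^ (N - 1) := by
    funext σ
    refine intervalIntegral.integral_congr fun r hr => ?_
    rw [uIcc_of_le hab] at hr
    simp only [max_eq_left hr.1]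
  rw [heq]
  obtain ⟨n, rfl⟩ := Nat.exists_eq_add_of_le' hN
  have hμ : μH[((n + 1 : ℕ) : ℝ) - 1]
      (Metric.sphere (0 : EuclideanSpace ℝ (Fin (n + 1))) 1) < ⊤ := by
    rw [Nat.cast_succ, add_sub_cancel_right]
    exact hausdorffMeasure_sphere_lt_top_s3 n
  exact hcont.continuousOn.integrableOn_of_subset_isCompact (isCompact_sphere _ _)
    Metric.isClosed_sphere.measurableSet subset_rfl hμ.ne

theorem continuous_radGrad {N : ℕ} {u : ℝ → EuclideanSpace ℝ (Fin N) → ℝ}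
    (hu : ContDiff ℝ 1 (Function.uncurry u)) : Continuous (Function.uncurry (radGrad N u)) := by
  have h : Function.uncurry (radGrad N u) = fun x => fderiv ℝ (Function.uncurry u) x (1, 0) := by
    funext ⟨r, σ⟩
    exact ((hu.differentiable one_ne_zero (r, σ)).hasFDerivAt.comp_hasDerivAt r
      ((hasDerivAt_id r).prodMk (hasDerivAt_const r σ))).deriv
  rw [h]
  exact (hu.continuous_fderiv one_ne_zero).clm_apply continuous_const

/-- Weighted Hardy inequality with radial derivative on `ℍ^N` for `0 ≤ 2α ≤ N-3`. -/
theorem weighted_radial_hardy (N : ℕ) (hN : 3 ≤ N) (α : ℝ)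
    (hα0 : 0 ≤ 2 * α) (hα : 2 * α ≤ (N : ℝ) - 3)
    (u : ℝ → EuclideanSpace ℝ (Fin N) → ℝ) (hu : IsCcAway N u) :
    hypInt N (fun r σ => (radGrad N u r σ) ^ 2 / r ^ α) ≥
      (((N : ℝ) - 2 - α) ^ 2 / 4) * hypInt N (fun r σ => (u r σ) ^ 2 / r ^ (α + 2))
      + (((N : ℝ) - 1) / 2) * hypInt N (fun r σ => (u r σ) ^ 2 / r ^ α) := by
  obtain ⟨hsmooth, a, b, ha, hab, hsupp⟩ := hu
  have hu1 : ContDiff ℝ 1 (Function.uncurry u) := hsmooth.of_le (by exact_mod_cast le_top)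
  have ha' : 0 < a / 2 := by positivity
  have hab' : a / 2 ≤ b + 1 := by linarith
  have hIcc : Icc a b ⊆ Icc (a / 2) (b + 1) := Icc_subset_Icc (by linarith) (by linarith)
  have hgrad : ∀ r ∉ Icc a b, ∀ σ ∈ Metric.sphere (0 : EuclideanSpace ℝ (Fin N)) 1,
      radGrad N u r σ = 0 := fun r hr σ hσ => by
    have h : (fun s => u s σ) =ᶠ[nhds r] fun _ => 0 :=
      Filter.eventually_of_mem (isClosed_Icc.isOpen_compl.mem_nhds hr) fun s hs => hsupp s hs σ hσ
    exact h.deriv_eq.trans (deriv_const r 0)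
  have hint := fun β => integrableOn_sphere_weighted (by omega : 1 ≤ N) ha' hab' β hu1.continuous
  rw [hypInt_eq_of_support ha' hab' fun r hr σ hσ => by
      simp [hgrad r (fun h => hr (hIcc h)) σ hσ],
    hypInt_eq_of_support ha' hab' fun r hr σ hσ => by
      simp [hsupp r (fun h => hr (hIcc h)) σ hσ],
    hypInt_eq_of_support ha' hab' fun r hr σ hσ => by
      simp [hsupp r (fun h => hr (hIcc h)) σ hσ], ge_iff_le,
    ← integral_const_mul, ← integral_const_mul,
    ← integral_add ((hint _).const_mul _) ((hint _).const_mul _)]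
  refine setIntegral_mono_on (((hint _).const_mul _).add ((hint _).const_mul _))
    (integrableOn_sphere_weighted (by omega) ha' hab' α (continuous_radGrad hu1))
    Metric.isClosed_sphere.measurableSet fun σ hσ => ?_
  have hcast : ((N - 1 : ℕ) : ℝ) = (N : ℝ) - 1 := by
    rw [Nat.cast_sub (by omega), Nat.cast_one]
  have key := weighted_hardy_interval (k := N - 1) hα0 (by rw [hcast]; linarith) ha' hab'
    (f := fun s => u s σ) (hu1.comp (contDiff_id.prodMk contDiff_const))
    (hsupp _ (fun h => by linarith [h.1]) σ hσ) (hsupp _ (fun h => by linarith [h.2]) σ hσ)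
  rw [hcast, show (N : ℝ) - 1 - 1 - α = N - 2 - α by ring] at key
  exact key
end
end
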